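/- Let A ∈ GL_n(ℚ) and let L ≤ ℤ^n ∩ A⁻¹(ℤ^n) be a finite-index subgroup. Then the group G(A,L) is polycyclic — equivalently, solvable with every subgroup finitely generated — if and only if L = AL = ℤ^n. -/

import Mathlib

open Matrix

noncomputable section

/-- The coercion `ℤ^n → ℚ^n` as an additive homomorphism. -/
def ZtoQ (n : ℕ) : (Fin n → ℤ) →+ (Fin n → ℚ) :=
  AddMonoidHom.mk' (fun v i => (v i : ℚ)) (by intro a b; funext i; simp)

/-- The image `A·L ⊆ ℚ^n` of a subgroup `L ≤ ℤ^n` under the matrix `A`. -/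
def QImage {n : ℕ} (A : Matrix (Fin n) (Fin n) ℚ) (L : AddSubgroup (Fin n → ℤ)) :
    AddSubgroup (Fin n → ℚ) :=
  (L.map (ZtoQ n)).map A.mulVecLin.toAddMonoidHom

/-- The subgroup `AL` of `ℤ^n`, i.e. the set of integer vectors lying in `A·L`. -/
def ALsub {n : ℕ} (A : Matrix (Fin n) (Fin n) ℚ) (L : AddSubgroup (Fin n → ℤ)) :
    AddSubgroup (Fin n → ℤ) :=
  (QImage A L).comap (ZtoQ n)

/-- `x^v = x_1^{v_1} ⋯ x_n^{v_n}` in the free group on `x_1,…,x_n,t`. -/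
def xWord (n : ℕ) (v : Fin n → ℤ) : FreeGroup (Fin n ⊕ Unit) :=
  (List.ofFn fun i => (FreeGroup.of (Sum.inl i) : FreeGroup (Fin n ⊕ Unit)) ^ (v i)).prod

/-- The relations of the Leary–Minasyan group `G(A,L)`. -/
def LMrels (n : ℕ) (A : Matrix (Fin n) (Fin n) ℚ) (L : AddSubgroup (Fin n → ℤ)) :
    Set (FreeGroup (Fin n ⊕ Unit)) :=
  {r | (∃ i j : Fin n,
          r = FreeGroup.of (Sum.inl i) * FreeGroup.of (Sum.inl j) *
              (FreeGroup.of (Sum.inl i))⁻¹ * (FreeGroup.of (Sum.inl j))⁻¹) ∨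
       (∃ v ∈ L, ∃ w : Fin n → ℤ, ZtoQ n w = A.mulVec (ZtoQ n v) ∧
          r = FreeGroup.of (Sum.inr ()) * xWord n v * (FreeGroup.of (Sum.inr ()))⁻¹ *
              (xWord n w)⁻¹)}

/-- The Leary–Minasyan group `G(A,L)`. -/
abbrev LM (n : ℕ) (A : Matrix (Fin n) (Fin n) ℚ) (L : AddSubgroup (Fin n → ℤ)) :=
  PresentedGroup (LMrels n A L)

/-- The generator `x_i` of `G(A,L)`. -/
def Xg (n : ℕ) (A : Matrix (Fin n) (Fin n) ℚ) (L : AddSubgroup (Fin n → ℤ)) (i : Fin n) :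
    LM n A L :=
  PresentedGroup.of (Sum.inl i)

/-- The stable letter `t` of `G(A,L)`. -/
def Tg (n : ℕ) (A : Matrix (Fin n) (Fin n) ℚ) (L : AddSubgroup (Fin n → ℤ)) : LM n A L :=
  PresentedGroup.of (Sum.inr ())

/-- The element `x^v` of `G(A,L)`. -/
def Xv (n : ℕ) (A : Matrix (Fin n) (Fin n) ℚ) (L : AddSubgroup (Fin n → ℤ)) (v : Fin n → ℤ) :
    LM n A L :=
  (List.ofFn fun i => (Xg n A L i) ^ (v i)).prod

/-- The base subgroup `H = ⟨x_1,…,x_n⟩` of `G(A,L)`. -/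
def Hsub (n : ℕ) (A : Matrix (Fin n) (Fin n) ℚ) (L : AddSubgroup (Fin n → ℤ)) :
    Subgroup (LM n A L) :=
  Subgroup.closure (Set.range (Xg n A L))

/-- The set `⋃_{j∈ℤ} A^j(ℤ^n) ⊆ ℚ^n`. -/
def unionSet {n : ℕ} (A : Matrix (Fin n) (Fin n) ℚ) : Set (Fin n → ℚ) :=
  ⋃ j : ℤ, (A ^ j).mulVec '' Set.range (ZtoQ n)

/-- Cast an integer matrix to a rational matrix. -/
def QMat {k : ℕ} (M : Matrix (Fin k) (Fin k) ℤ) : Matrix (Fin k) (Fin k) ℚ :=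
  M.map (Int.cast)

/-- The block matrix `[[1, 0ᵀ],[u, C]]`. -/
def blockOne {k : ℕ} (u : Fin k → ℤ) (C : Matrix (Fin k) (Fin k) ℤ) :
    Matrix (Fin (k+1)) (Fin (k+1)) ℤ :=
  Matrix.of fun i j =>
    Fin.cases (Fin.cases 1 (fun _ => 0) j) (fun i' => Fin.cases (u i') (fun j' => C i' j') j) i

/-- Transport a subgroup of `ℤ^a` along an equality `a = b` of dimensions. -/
def reindexSub {a b : ℕ} (h : a = b) (L : AddSubgroup (Fin a → ℤ)) :
    AddSubgroup (Fin b → ℤ) :=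
  L.map (AddMonoidHom.mk' (fun v => v ∘ (finCongr h).symm) (fun _ _ => rfl))


section HNN

variable {G : Type*} [Group G] {A B : Subgroup G} (φ : A ≃* B)

open HNNExtension HNNExtension.NormalWord

/-- All partial sums of `c + ∑ u * vᵢ`, for `vᵢ` the successive exponents occurring in a word,
are nonpositive. -/
def HeightNonpos (u : ℤˣ) : ℤ → List (ℤˣ × G) → Prop
  | c, [] => c ≤ 0
  | c, p :: l => c ≤ 0 ∧ HeightNonpos u (c + u * p.1) l

theorem HeightNonpos.unitsSMul {d : TransversalPair G A B} {u : ℤˣ} (v : ℤˣ) {c : ℤ}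
    {w : NormalWord d} (hw : HeightNonpos u c w.toList) (hc : c - u * v ≤ 0) :
    HeightNonpos u (c - u * v) (unitsSMul φ v w).toList := by
  by_cases h : Cancels v w
  · simp only [NormalWord.unitsSMul, h, dite_true]
    induction w using consRecOn with
    | ofGroup => simp [Cancels] at h
    | cons g u' w h1 h2 _ =>
      have hu : u' = -v := by simpa [Cancels] using h.2
      subst hu
      have := hw.2
      simpa [unitsSMulWithCancel, sub_eq_add_neg] using this
  · simp only [NormalWord.unitsSMul, dif_neg h]
    refine ⟨hc, ?_⟩
    simpa using hw

theorem HeightNonpos.zpow_smul {d : TransversalPair G A B} {u : ℤˣ} {c : ℤ}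
    {w : NormalWord d} (hw : HeightNonpos u c w.toList) (hc0 : c ≤ 0) (i : ℤ) (hc : c - i ≤ 0) :
    HeightNonpos u (c - i)
      (((t ^ (u : ℤ)) ^ i : HNNExtension G A B φ) • w).toList := by
  have hu : (u : ℤ) * u = 1 := by simp
  induction i with
  | zero => simpa using hw
  | succ k ih =>
    have := (ih (by omega)).unitsSMul φ u (by rw [hu]; omega)
    rw [add_comm (k : ℤ) 1, _root_.zpow_add, zpow_one, mul_smul,
      t_pow_smul_eq_unitsSMul]
    convert this using 1
    rw [hu]; ring
  | pred k ih =>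
    have := (ih (by omega)).unitsSMul φ (-u) (by push_cast; rw [mul_neg, hu]; omega)
    rw [sub_eq_neg_add (-(k : ℤ)) 1, _root_.zpow_add, _root_.zpow_neg_one, mul_smul, ← _root_.zpow_neg,
      ← Units.val_neg, t_pow_smul_eq_unitsSMul]
    convert this using 1
    push_cast
    rw [mul_neg, hu]; ring

/-- The subgroup generated by the conjugates of the base group by `t ^ (u * i)`, for `i ≤ m`. -/
def heightSubgroup (u : ℤˣ) (m : ℤ) : Subgroup (HNNExtension G A B φ) :=
  Subgroup.closure {x | ∃ i ≤ m, ∃ h : G,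
    x = (t ^ (u : ℤ)) ^ i * HNNExtension.of h * (t ^ (u : ℤ)) ^ (-i)}

theorem heightSubgroup_mono (u : ℤˣ) : Monotone (heightSubgroup φ u) := by
  intro a b hab
  refine Subgroup.closure_mono ?_
  rintro x ⟨i, hi, h⟩
  exact ⟨i, hi.trans hab, h⟩

theorem HeightNonpos.smul_of_mem {d : TransversalPair G A B} {u : ℤˣ} {m : ℕ}
    {x : HNNExtension G A B φ} (hx : x ∈ heightSubgroup φ u m) {w : NormalWord d}
    (hw : HeightNonpos u (-m) w.toList) : HeightNonpos u (-m) (x • w).toList := by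
  have gen : ∀ i : ℤ, i ≤ m → ∀ h : G, ∀ w : NormalWord d, HeightNonpos u (-m) w.toList →
      HeightNonpos u (-m) ((((t ^ (u : ℤ)) ^ i * HNNExtension.of h * (t ^ (u : ℤ)) ^ (-i) :
        HNNExtension G A B φ)) • w).toList := by
    intro i hi h w hw
    rw [mul_smul, mul_smul]
    have h1 := hw.zpow_smul φ (by omega) (-i) (by omega)
    rw [← group_smul_toList h, ← of_smul_eq_smul (φ := φ)] at h1
    have h2 := h1.zpow_smul φ (by omega) i (by omega)
    simpa using h2
  induction hx using Subgroup.closure_induction'' generalizing w with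
  | one => simpa using hw
  | mem x hx =>
    obtain ⟨i, hi, h, rfl⟩ := hx
    exact gen i hi h w hw
  | inv_mem x hx =>
    obtain ⟨i, hi, h, rfl⟩ := hx
    have := gen i hi h⁻¹ w hw
    convert this using 4
    simp [mul_assoc]
  | mul x y _ _ hx hy =>
    rw [mul_smul]
    exact hx (hy hw)

theorem conj_notMem_heightSubgroup (u : ℤˣ) (m : ℕ) {h : G} (hh : h ∉ toSubgroup A B u) :
    ((t ^ (u : ℤ)) ^ (m + 1 : ℤ) * HNNExtension.of h * (t ^ (u : ℤ)) ^ (-(m + 1) : ℤ) :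
      HNNExtension G A B φ) ∉ heightSubgroup φ u m := by
  intro hmem
  obtain ⟨d⟩ := TransversalPair.nonempty G A B
  have h0 : HeightNonpos u 0 (NormalWord.empty : NormalWord d).toList := le_rfl
  have h1 := h0.zpow_smul φ le_rfl m (by omega)
  rw [zero_sub] at h1
  have h2 := (h1.smul_of_mem φ hmem).zpow_smul φ (by omega) (-m) (by omega)
  rw [smul_smul, smul_smul] at h2
  have e : ((t ^ (u : ℤ)) ^ (-m : ℤ) * ((t ^ (u : ℤ)) ^ (m + 1 : ℤ) * HNNExtension.of h *
      (t ^ (u : ℤ)) ^ (-(m + 1) : ℤ) * (t ^ (u : ℤ)) ^ (m : ℤ)) : HNNExtension G A B φ) =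
      t ^ (u : ℤ) * (HNNExtension.of h * t ^ ((-u : ℤˣ) : ℤ)) := by
    push_cast
    rw [_root_.zpow_neg t]
    generalize (t ^ (u : ℤ) : HNNExtension G A B φ) = s
    group
  simp only [mul_assoc] at h2 e
  rw [e, mul_smul, mul_smul, t_pow_smul_eq_unitsSMul, t_pow_smul_eq_unitsSMul,
    of_smul_eq_smul] at h2
  have c1 : ¬ Cancels (-u) (NormalWord.empty : NormalWord d) := by simp [Cancels]
  have c2 : ¬ Cancels u (h • NormalWord.unitsSMul φ (-u) (NormalWord.empty : NormalWord d)) := by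
    intro hc
    apply hh
    have := hc.1
    simp only [NormalWord.unitsSMul, dif_neg c1, group_smul_head, cons_head] at this
    refine (Subgroup.mul_mem_cancel_right _ ?_).1 this
    have := (unitsSMulGroup φ d (-u) (NormalWord.empty : NormalWord d).head).1.2
    simpa using this
  rw [NormalWord.unitsSMul, dif_neg c2] at h2
  have h3 := h2.2
  simp only [group_smul_toList] at h3
  rw [NormalWord.unitsSMul, dif_neg c1] at h3
  have h4 := h3.1
  simp at h4

theorem Subgroup.exists_iSup_eq_of_fg {G : Type*} [Group G] {f : ℕ → Subgroup G} (hf : Monotone f)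
    (h : (⨆ m, f m).FG) : ∃ m, ⨆ m, f m = f m := by
  obtain ⟨S, hS⟩ := h
  have hmem : ∀ s ∈ S, ∃ m, s ∈ f m := by
    intro s hs
    rw [← Subgroup.mem_iSup_of_directed hf.directed_le, ← hS]
    exact Subgroup.subset_closure hs
  choose! g hg using hmem
  refine ⟨S.sup g, le_antisymm ?_ (le_iSup f _)⟩
  rw [← hS, Subgroup.closure_le]
  intro s hs
  exact hf (Finset.le_sup hs) (hg s hs)

/-- If every subgroup of an HNN extension is finitely generated, then both associated subgroups
are the whole base group. -/
theorem HNNExtension.toSubgroup_eq_top_of_forall_fg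
    (hfg : ∀ K : Subgroup (HNNExtension G A B φ), K.FG) (u : ℤˣ) : toSubgroup A B u = ⊤ := by
  rw [Subgroup.eq_top_iff']
  intro h
  by_contra hh
  have hmono : Monotone fun m : ℕ => heightSubgroup φ u m :=
    (heightSubgroup_mono φ u).comp Nat.mono_cast
  obtain ⟨m, hm⟩ := Subgroup.exists_iSup_eq_of_fg hmono (hfg _)
  refine conj_notMem_heightSubgroup φ u m hh ?_
  rw [← hm]
  refine Subgroup.mem_iSup_of_mem (m + 1) (Subgroup.subset_closure ⟨m + 1, ?_, h, rfl⟩)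
  push_cast; rfl

end HNN

theorem Subgroup.fg_map {G H : Type*} [Group G] [Group H] {K : Subgroup G} (hK : K.FG)
    (f : G →* H) : (K.map f).FG := by
  rw [Subgroup.fg_iff_submonoid_fg] at hK ⊢
  exact hK.map f

/-- The homomorphism `ℤ^n → G` sending the standard basis to pairwise commuting elements. -/
def monomialHom {G : Type*} [Group G] {n : ℕ} (x : Fin n → G)
    (hx : ∀ i j, Commute (x i) (x j)) : Multiplicative (Fin n → ℤ) →* G :=
  MonoidHom.mk' (fun v => (List.ofFn fun i => x i ^ (v.toAdd i)).prod) <| by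
    intro v w
    change (List.ofFn fun i => x i ^ (v.toAdd i + w.toAdd i)).prod = _
    generalize v.toAdd = v
    generalize w.toAdd = w
    induction n with
    | zero => simp
    | succ n ih =>
      have key : Commute (x 0 ^ w 0) (List.ofFn fun i : Fin n => x i.succ ^ v i.succ).prod := by
        refine Commute.list_prod_right _ _ fun y hy => ?_
        obtain ⟨i, rfl⟩ := List.mem_ofFn.1 hy
        exact ((hx _ _).zpow_left _).zpow_right _
      simp only [List.ofFn_succ, List.prod_cons]
      rw [ih (fun i => x i.succ) (fun i j => hx _ _) (fun i => v i.succ) (fun i => w i.succ),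
        _root_.zpow_add]
      simp only [mul_assoc]
      rw [← mul_assoc (x 0 ^ w 0), key.eq, mul_assoc]

theorem monomialHom_ofAdd {G : Type*} [Group G] {n : ℕ} (x : Fin n → G)
    (hx : ∀ i j, Commute (x i) (x j)) (v : Fin n → ℤ) :
    monomialHom x hx (Multiplicative.ofAdd v) = (List.ofFn fun i => x i ^ v i).prod := rfl

theorem monomialHom_single {G : Type*} [Group G] {n : ℕ} (x : Fin n → G)
    (hx : ∀ i j, Commute (x i) (x j)) (i : Fin n) :
    monomialHom x hx (Multiplicative.ofAdd (Pi.single i 1)) = x i := by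
  rw [monomialHom_ofAdd]
  clear hx
  induction n with
  | zero => exact i.elim0
  | succ n ih =>
    rw [List.ofFn_succ, List.prod_cons]
    cases i using Fin.cases with
    | zero => simp
    | succ j =>
      have := ih (fun i => x i.succ) j
      simpa [Pi.single_apply] using this

theorem map_xWord {G : Type*} [Group G] (n : ℕ) (f : FreeGroup (Fin n ⊕ Unit) →* G)
    (v : Fin n → ℤ) :
    f (xWord n v) = (List.ofFn fun i => f (FreeGroup.of (Sum.inl i)) ^ v i).prod := by
  simp [xWord, map_list_prod, List.map_ofFn, Function.comp_def]

theorem prod_ofAdd_single_zpow (n : ℕ) (v : Fin n → ℤ) :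
    (List.ofFn fun i => (Multiplicative.ofAdd (Pi.single i (1 : ℤ) : Fin n → ℤ)) ^ v i).prod =
      Multiplicative.ofAdd v := by
  rw [List.prod_ofFn]
  apply Multiplicative.toAdd.injective
  simp only [toAdd_prod, toAdd_zpow, toAdd_ofAdd]
  ext j
  simp [Finset.sum_apply, Pi.single_apply]

theorem ZtoQ_injective (n : ℕ) : Function.Injective (ZtoQ n) := by
  intro v w h
  ext i
  have := congrFun h i
  simpa [ZtoQ] using this

section Associated

variable {n : ℕ} {A : Matrix (Fin n) (Fin n) ℚ} {L : AddSubgroup (Fin n → ℤ)}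

theorem exists_ZtoQ_eq_mulVec (hLA : QImage A L ≤ (ZtoQ n).range) (v : L) :
    ∃ w : Fin n → ℤ, ZtoQ n w = A.mulVec (ZtoQ n v) :=
  hLA ⟨ZtoQ n v, ⟨v, v.2, rfl⟩, rfl⟩

/-- Multiplication by `A` as a homomorphism `L → ℤ^n`, in multiplicative notation. -/
def assocHom (hLA : QImage A L ≤ (ZtoQ n).range) :
    AddSubgroup.toSubgroup L →* Multiplicative (Fin n → ℤ) :=
  MonoidHom.mk' (fun v => Multiplicative.ofAdd
    (exists_ZtoQ_eq_mulVec hLA ⟨v.1.toAdd, v.2⟩).choose) <| by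
    intro a b
    apply Multiplicative.toAdd.injective
    apply ZtoQ_injective
    rw [toAdd_mul, map_add, toAdd_ofAdd, toAdd_ofAdd, toAdd_ofAdd,
      (exists_ZtoQ_eq_mulVec hLA _).choose_spec, (exists_ZtoQ_eq_mulVec hLA _).choose_spec,
      (exists_ZtoQ_eq_mulVec hLA _).choose_spec, ← Matrix.mulVec_add, ← map_add]
    rfl

theorem ZtoQ_assocHom (hLA : QImage A L ≤ (ZtoQ n).range) (v : AddSubgroup.toSubgroup L) :
    ZtoQ n (assocHom hLA v).toAdd = A.mulVec (ZtoQ n v.1.toAdd) :=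
  (exists_ZtoQ_eq_mulVec hLA ⟨v.1.toAdd, v.2⟩).choose_spec

theorem assocHom_injective (hA : IsUnit A.det) (hLA : QImage A L ≤ (ZtoQ n).range) :
    Function.Injective (assocHom hLA) := by
  intro a b h
  have h1 := ZtoQ_assocHom hLA a
  rw [h, ZtoQ_assocHom] at h1
  have h2 := Matrix.mulVec_injective_of_isUnit ((Matrix.isUnit_iff_isUnit_det A).2 hA) h1
  exact Subtype.ext (Multiplicative.toAdd.injective (ZtoQ_injective n h2.symm))

theorem assocHom_range (hLA : QImage A L ≤ (ZtoQ n).range) :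
    (assocHom hLA).range = AddSubgroup.toSubgroup (ALsub A L) := by
  ext w
  constructor
  · rintro ⟨v, rfl⟩
    exact ⟨ZtoQ n v.1.toAdd, ⟨v.1.toAdd, v.2, rfl⟩, (ZtoQ_assocHom hLA v).symm⟩
  · rintro ⟨_, ⟨v, hv, rfl⟩, h⟩
    refine ⟨⟨Multiplicative.ofAdd v, hv⟩, ?_⟩
    apply Multiplicative.toAdd.injective
    apply ZtoQ_injective
    rw [ZtoQ_assocHom]
    exact h

/-- The group `G(A,L)` as an HNN extension in Mathlib's sense. -/
abbrev LMHNN (hA : IsUnit A.det) (hLA : QImage A L ≤ (ZtoQ n).range) :=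
  HNNExtension (Multiplicative (Fin n → ℤ)) (AddSubgroup.toSubgroup L) (assocHom hLA).range
    (MonoidHom.ofInjective (assocHom_injective hA hLA))

/-- The images in the HNN extension of the generators of `G(A,L)`. -/
def LMHNN.gen (hA : IsUnit A.det) (hLA : QImage A L ≤ (ZtoQ n).range) :
    Fin n ⊕ Unit → LMHNN hA hLA :=
  Sum.elim (fun i => HNNExtension.of (Multiplicative.ofAdd (Pi.single i 1)))
    (fun _ => HNNExtension.t)

theorem LMHNN.lift_xWord (hA : IsUnit A.det) (hLA : QImage A L ≤ (ZtoQ n).range)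
    (v : Fin n → ℤ) :
    FreeGroup.lift (LMHNN.gen hA hLA) (xWord n v) = HNNExtension.of (Multiplicative.ofAdd v) := by
  rw [map_xWord, ← prod_ofAdd_single_zpow, map_list_prod]
  simp [LMHNN.gen, List.map_ofFn, Function.comp_def]

/-- The canonical homomorphism from `G(A,L)` to the HNN extension. -/
def LM.toHNN (hA : IsUnit A.det) (hLA : QImage A L ≤ (ZtoQ n).range) :
    LM n A L →* LMHNN hA hLA :=
  PresentedGroup.toGroup (f := LMHNN.gen hA hLA) <| by
    rintro r (⟨i, j, rfl⟩ | ⟨v, hv, w, hw, rfl⟩)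
    · simp only [map_mul, map_inv, FreeGroup.lift_apply_of, LMHNN.gen, Sum.elim_inl]
      rw [← map_mul, mul_comm, map_mul]
      group
    · simp only [map_mul, map_inv, LMHNN.lift_xWord, FreeGroup.lift_apply_of]
      have e : Multiplicative.ofAdd w = assocHom hLA ⟨Multiplicative.ofAdd v, hv⟩ := by
        apply Multiplicative.toAdd.injective
        apply ZtoQ_injective
        rw [ZtoQ_assocHom]
        exact hw
      have := HNNExtension.t_mul_of (φ := MonoidHom.ofInjective (assocHom_injective hA hLA))
        ⟨Multiplicative.ofAdd v, hv⟩
      simp only [MonoidHom.ofInjective_apply] at this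
      rw [← e] at this
      simp only [LMHNN.gen, Sum.elim_inr]
      rw [this]
      group

theorem LM.toHNN_surjective (hA : IsUnit A.det) (hLA : QImage A L ≤ (ZtoQ n).range) :
    Function.Surjective (LM.toHNN hA hLA) := by
  rw [← MonoidHom.range_eq_top, Subgroup.eq_top_iff']
  intro x
  have hof : ∀ v : Multiplicative (Fin n → ℤ), (HNNExtension.of v : LMHNN hA hLA) ∈
      (LM.toHNN hA hLA).range := by
    intro v
    exact ⟨PresentedGroup.mk _ (xWord n v.toAdd), LMHNN.lift_xWord hA hLA v.toAdd⟩
  induction x using HNNExtension.induction_on with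
  | of g => exact hof g
  | t => exact ⟨PresentedGroup.of (Sum.inr ()), PresentedGroup.toGroup.of _⟩
  | mul x y hx hy => exact mul_mem hx hy
  | inv x hx => exact inv_mem hx

theorem eq_top_of_forall_subgroup_fg (hA : IsUnit A.det) (hLA : QImage A L ≤ (ZtoQ n).range)
    (hfg : ∀ K : Subgroup (LM n A L), K.FG) : L = ⊤ ∧ ALsub A L = ⊤ := by
  have hfg' : ∀ K : Subgroup (LMHNN hA hLA), K.FG := by
    intro K
    rw [← Subgroup.map_comap_eq_self_of_surjective (LM.toHNN_surjective hA hLA) K]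
    exact Subgroup.fg_map (hfg _) _
  have h1 := HNNExtension.toSubgroup_eq_top_of_forall_fg _ hfg' 1
  have h2 := HNNExtension.toSubgroup_eq_top_of_forall_fg _ hfg' (-1)
  rw [HNNExtension.toSubgroup_one] at h1
  rw [HNNExtension.toSubgroup_neg_one, assocHom_range] at h2
  constructor
  · exact AddSubgroup.toSubgroup.injective (h1.trans (map_top _).symm)
  · exact AddSubgroup.toSubgroup.injective (h2.trans (map_top _).symm)

end Associated

theorem Group.isSolvable_of_commutative_of_isCyclic_quotient {G : Type*} [Group G]
    (N : Subgroup G) [N.Normal] [IsCyclic (G ⧸ N)] (hN : ∀ a b : N, a * b = b * a) :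
    Group.IsSolvable G := by
  have : Group.IsSolvable N := Group.isSolvable_of_comm hN
  have : Group.IsSolvable (G ⧸ N) := Group.isSolvable_of_comm fun a b =>
    IsCyclic.isMulCommutative.is_comm.comm a b
  exact Group.isSolvable_of_ker_le_range N.subtype (QuotientGroup.mk' N) (by simp)

theorem Subgroup.FG.of_fg_inf_of_isCyclic_quotient {G : Type*} [Group G] (N : Subgroup G)
    [N.Normal] [IsCyclic (G ⧸ N)] (K : Subgroup G) (hK : (K ⊓ N).FG) : K.FG := by
  obtain ⟨q, hq⟩ := (Subgroup.isCyclic_iff_exists_zpowers_eq_top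
    (K.map (QuotientGroup.mk' N))).1 inferInstance
  obtain ⟨k, hkK, rfl⟩ : q ∈ K.map (QuotientGroup.mk' N) := hq ▸ Subgroup.mem_zpowers q
  have : K = (K ⊓ N) ⊔ Subgroup.zpowers k := by
    refine le_antisymm (fun x hx => ?_) (sup_le inf_le_left (by simpa using hkK))
    have hx' : QuotientGroup.mk' N x ∈ K.map (QuotientGroup.mk' N) := ⟨x, hx, rfl⟩
    rw [← hq] at hx'
    obtain ⟨i, hi⟩ := hx'
    have hmem : x * (k ^ i)⁻¹ ∈ K ⊓ N := by
      refine ⟨K.mul_mem hx (K.inv_mem (K.zpow_mem hkK i)), ?_⟩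
      change _ ∈ N
      rw [← QuotientGroup.ker_mk' N, MonoidHom.mem_ker, map_mul, map_inv, map_zpow]
      simp only at hi
      rw [hi, mul_inv_cancel]
    have := Subgroup.mul_mem_sup hmem (Subgroup.zpow_mem_zpowers k i)
    simpa using this
  rw [this]
  refine hK.sup ?_
  rw [Subgroup.zpowers_eq_closure]
  exact ⟨{k}, by simp⟩

theorem Subgroup.fg_multiplicative_pi_int (n : ℕ)
    (K : Subgroup (Multiplicative (Fin n → ℤ))) : K.FG := by
  have h := IsNoetherian.noetherian (R := ℤ)
    (AddSubgroup.toIntSubmodule (AddSubgroup.toSubgroup.symm K))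
  rw [Submodule.fg_iff_addSubgroup_fg, AddSubgroup.fg_iff_mul_fg] at h
  exact h

/-- If `L = AL = ℤ^n`, then `G(A,L)` is an extension of a finitely generated abelian group by a
cyclic group, hence polycyclic. -/
theorem LM_isSolvable_and_fg {n : ℕ} {A : Matrix (Fin n) (Fin n) ℚ}
    {L : AddSubgroup (Fin n → ℤ)} (hLA : QImage A L ≤ (ZtoQ n).range) (hL : L = ⊤)
    (hAL : ALsub A L = ⊤) :
    Group.IsSolvable (LM n A L) ∧ ∀ K : Subgroup (LM n A L), K.FG := by
  have hcomm : ∀ i j, Commute (Xg n A L i) (Xg n A L j) := by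
    intro i j
    have : PresentedGroup.mk (LMrels n A L) _ = 1 :=
      PresentedGroup.one_of_mem (Or.inl ⟨i, j, rfl⟩)
    simp only [map_mul, map_inv] at this
    exact mul_inv_eq_iff_eq_mul.1 (mul_inv_eq_one.1 this)
  set X := monomialHom (Xg n A L) hcomm
  have hrel : ∀ v w : Fin n → ℤ, ZtoQ n w = A.mulVec (ZtoQ n v) →
      Tg n A L * X (Multiplicative.ofAdd v) * (Tg n A L)⁻¹ = X (Multiplicative.ofAdd w) := by
    intro v w h
    have : PresentedGroup.mk (LMrels n A L) _ = 1 :=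
      PresentedGroup.one_of_mem (Or.inr ⟨v, by simp [hL], w, h, rfl⟩)
    simp only [map_mul, map_inv, map_xWord] at this
    exact mul_inv_eq_one.1 this
  have hXr : ∀ i, Xg n A L i ∈ X.range := fun i => ⟨_, monomialHom_single _ hcomm i⟩
  have hTmem : ∀ g, g ∈ X.range ↔ Tg n A L * g * (Tg n A L)⁻¹ ∈ X.range := by
    intro g
    constructor
    · rintro ⟨v, rfl⟩
      obtain ⟨w, hw⟩ := exists_ZtoQ_eq_mulVec hLA ⟨v.toAdd, hL ▸ AddSubgroup.mem_top _⟩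
      exact ⟨_, (hrel v.toAdd w hw).symm⟩
    · rintro ⟨w, hw⟩
      obtain ⟨_, ⟨v, _, rfl⟩, h⟩ : w.toAdd ∈ ALsub A L := hAL ▸ AddSubgroup.mem_top _
      refine ⟨Multiplicative.ofAdd v, ?_⟩
      have := (hrel v w.toAdd h.symm).trans hw
      simpa using this
  have hNorm : X.range.Normal := by
    rw [← Subgroup.normalizer_eq_top_iff, eq_top_iff, ← PresentedGroup.closure_range_of,
      Subgroup.closure_le]
    rintro _ ⟨i | ⟨⟩, rfl⟩
    · exact Subgroup.le_normalizer (hXr i)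
    · exact Subgroup.mem_normalizer_iff.2 hTmem
  have hquot : ∀ q : LM n A L ⧸ X.range, q ∈ Subgroup.zpowers (Tg n A L : LM n A L ⧸ X.range) := by
    intro q
    obtain ⟨g, rfl⟩ := QuotientGroup.mk'_surjective X.range q
    rw [← Subgroup.mem_comap]
    have : (⊤ : Subgroup (LM n A L)) ≤ (Subgroup.zpowers
        (Tg n A L : LM n A L ⧸ X.range)).comap (QuotientGroup.mk' X.range) := by
      rw [← PresentedGroup.closure_range_of, Subgroup.closure_le]
      rintro _ ⟨i | ⟨⟩, rfl⟩
      · have : QuotientGroup.mk' X.range (Xg n A L i) = 1 := by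
          rw [← MonoidHom.mem_ker, QuotientGroup.ker_mk']
          exact hXr i
        rw [SetLike.mem_coe, Subgroup.mem_comap]
        exact this ▸ one_mem _
      · exact Subgroup.mem_zpowers _
    exact this (Subgroup.mem_top g)
  have : IsCyclic (LM n A L ⧸ X.range) := ⟨_, hquot⟩
  refine ⟨Group.isSolvable_of_commutative_of_isCyclic_quotient X.range ?_, fun K => ?_⟩
  · rintro ⟨_, a, rfl⟩ ⟨_, b, rfl⟩
    apply Subtype.ext
    change X a * X b = X b * X a
    rw [← map_mul, mul_comm, map_mul]
  · refine Subgroup.FG.of_fg_inf_of_isCyclic_quotient X.range K ?_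
    rw [inf_comm, ← Subgroup.map_comap_eq]
    exact Subgroup.fg_map (Subgroup.fg_multiplicative_pi_int n _) _

/-- **Lemma.** `G(A,L)` is polycyclic (equivalently: solvable with every subgroup
finitely generated) iff `L = AL = ℤ^n`. -/
theorem LM_polycyclic_iff
    (n : ℕ) (A : Matrix (Fin n) (Fin n) ℚ) (hA : IsUnit A.det)
    (L : AddSubgroup (Fin n → ℤ)) (hL : L.FiniteIndex)
    (hLA : QImage A L ≤ (ZtoQ n).range) :
    (IsSolvable (LM n A L) ∧ ∀ K : Subgroup (LM n A L), K.FG) ↔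
      (L = ⊤ ∧ ALsub A L = ⊤) := by
  refine ⟨fun h => eq_top_of_forall_subgroup_fg hA hLA h.2, fun h => ?_⟩
  exact LM_isSolvable_and_fg hLA h.1 h.2
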